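/- arXiv:1412.4971 — 4 statements merged into one kernel-verified Lean document; each statement's English description precedes it below -/
import Mathlib

section
/- Let $n$ be a positive integer and assume that $\log K_n$ is convex on $(0,\infty)$. Then for every $x \ge 0$, $K_n(x)^2 \le \frac{2\exp\left(\sqrt{1+(4nx)^2}-1-4nx\right)}{\sqrt{1+(4nx)^2}+1}$. -/
open Real Set

/-- `K n x = e^{-2nx} ∑_{k≥0} (nx)^{2k}/(k!)²`, the sum of the squares of the
Szász–Mirakyan basis functions. -/
noncomputable def szaszK (n : ℕ) (x : ℝ) : ℝ :=
  Real.exp (-2 * n * x) * ∑' k : ℕ, ((n : ℝ) * x) ^ (2 * k) / (Nat.factorial k : ℝ) ^ 2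

/-- The series `∑ yᵏ / (k! (k+j)!)`, so that `besselSeries j (z²) = z⁻ʲ I_j(2z)`. -/
noncomputable def besselSeries (j : ℕ) (y : ℝ) : ℝ :=
  ∑' k : ℕ, 1 / ((Nat.factorial k : ℝ) * (Nat.factorial (k + j) : ℝ)) * y ^ k

lemma one_div_factorial_mul_le (j k : ℕ) :
    |1 / ((Nat.factorial k : ℝ) * (Nat.factorial (k + j) : ℝ))| ≤ 1 / (Nat.factorial k : ℝ) := by
  rw [abs_of_nonneg (by positivity)]
  have h : (1 : ℝ) ≤ (Nat.factorial (k + j) : ℝ) := by exact_mod_cast Nat.factorial_pos (k + j)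
  have h' : (0 : ℝ) < (Nat.factorial k : ℝ) := by exact_mod_cast Nat.factorial_pos k
  exact one_div_le_one_div_of_le h' (le_mul_of_one_le_right h'.le h)

lemma summable_mul_pow_of_le_factorial {c : ℕ → ℝ}
    (hc : ∀ k, |c k| ≤ 1 / (Nat.factorial k : ℝ)) (y : ℝ) : Summable fun k => c k * y ^ k := by
  refine Summable.of_norm_bounded (Real.summable_pow_div_factorial |y|) fun k => ?_
  rw [Real.norm_eq_abs, abs_mul, abs_pow, div_eq_inv_mul, ← one_div]
  gcongr
  exact hc k

lemma hasDerivAt_tsum_primitive_of_le_factorial {c : ℕ → ℝ}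
    (hc : ∀ k, |c k| ≤ 1 / (Nat.factorial k : ℝ)) (y : ℝ) :
    HasDerivAt (fun z => ∑' k : ℕ, c k / (k + 1) * z ^ (k + 1)) (∑' k, c k * y ^ k) y := by
  have hy : y ∈ Metric.ball (0 : ℝ) (|y| + 1) := by simp
  refine hasDerivAt_tsum_of_isPreconnected (g' := fun k z => c k * z ^ k) (y₀ := 0)
    (Real.summable_pow_div_factorial (|y| + 1)) Metric.isOpen_ball
    (convex_ball (0 : ℝ) (|y| + 1)).isPreconnected (fun k z _ => ?_) (fun k z hz => ?_)
    (Metric.mem_ball_self (by positivity)) (by simp [summable_zero]) hy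
  · convert! (hasDerivAt_pow (k + 1) z).const_mul (c k / (k + 1)) using 1
    push_cast
    field_simp
  · have hz' : |z| ≤ |y| + 1 := by simpa using (mem_ball_zero_iff.mp hz).le
    rw [Real.norm_eq_abs, abs_mul, abs_pow, div_eq_inv_mul, ← one_div]
    gcongr
    exact hc k

lemma summable_besselSeries (j : ℕ) (y : ℝ) :
    Summable fun k : ℕ => 1 / ((Nat.factorial k : ℝ) * (Nat.factorial (k + j) : ℝ)) * y ^ k :=
  summable_mul_pow_of_le_factorial (one_div_factorial_mul_le j) y

lemma hasDerivAt_besselSeries (j : ℕ) (y : ℝ) :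
    HasDerivAt (besselSeries j) (besselSeries (j + 1) y) y := by
  have h := (hasDerivAt_tsum_primitive_of_le_factorial
    (one_div_factorial_mul_le (j + 1)) y).const_add
    (1 / (Nat.factorial j : ℝ))
  refine h.congr_of_eventuallyEq (Filter.Eventually.of_forall fun z => ?_)
  rw [besselSeries, (summable_besselSeries j z).tsum_eq_zero_add]
  simp only [Nat.factorial_zero, Nat.cast_one, one_mul, zero_add, pow_zero, mul_one]
  congr 1
  refine tsum_congr fun k => ?_
  rw [Nat.factorial_succ k, show k + 1 + j = k + (j + 1) by omega]
  push_cast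
  field_simp

lemma hasDerivAt_mul_besselSeries_one (y : ℝ) :
    HasDerivAt (fun z => z * besselSeries 1 z) (besselSeries 0 y) y := by
  refine (hasDerivAt_tsum_primitive_of_le_factorial (one_div_factorial_mul_le 0)
    y).congr_of_eventuallyEq (Filter.Eventually.of_forall fun z => ?_)
  simp only [besselSeries]
  rw [← tsum_mul_left]
  refine tsum_congr fun k => ?_
  simp only [Nat.factorial_succ k, Nat.add_zero]
  push_cast
  field_simp
  ring

lemma besselSeries_zero_pos {y : ℝ} (hy : 0 ≤ y) : 0 < besselSeries 0 y :=
  (summable_besselSeries 0 y).tsum_pos (fun k => by positivity) 0 (by simp)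

lemma besselSeries_zero_at_zero : besselSeries 0 0 = 1 := by
  rw [besselSeries, tsum_eq_single 0 fun k hk => by simp [hk]]
  simp

/-- The differential equation `y A'' + A' = A` of `A = besselSeries 0`. -/
lemma mul_besselSeries_two_add (y : ℝ) :
    y * besselSeries 2 y + besselSeries 1 y = besselSeries 0 y := by
  have h := (hasDerivAt_id y).mul (hasDerivAt_besselSeries 1 y)
  have := h.unique (hasDerivAt_mul_besselSeries_one y)
  simp only [id] at this
  linarith

lemma szaszK_eq (n : ℕ) (x : ℝ) :
    szaszK n x = Real.exp (-2 * n * x) * besselSeries 0 ((n * x) ^ 2) := by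
  rw [szaszK, besselSeries]
  congr 1
  refine tsum_congr fun k => ?_
  rw [pow_mul, Nat.add_zero]
  ring

lemma szaszK_pos (n : ℕ) (x : ℝ) : 0 < szaszK n x := by
  rw [szaszK_eq]
  exact mul_pos (Real.exp_pos _) (besselSeries_zero_pos (sq_nonneg _))

/-- The logarithmic derivative of `besselSeries 0`. -/
noncomputable def besselRatio (y : ℝ) : ℝ := besselSeries 1 y / besselSeries 0 y

lemma hasDerivAt_sq_mul (a x : ℝ) : HasDerivAt (fun t => (a * t) ^ 2) (2 * a ^ 2 * x) x := by
  convert! ((hasDerivAt_id x).const_mul a).pow 2 using 1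
  simp only [id]
  push_cast
  ring

lemma hasDerivAt_log_szaszK (n : ℕ) (x : ℝ) :
    HasDerivAt (fun t => Real.log (szaszK n t))
      (-2 * n + 2 * n ^ 2 * x * besselRatio ((n * x) ^ 2)) x := by
  have hA := besselSeries_zero_pos (sq_nonneg ((n : ℝ) * x))
  have h := ((hasDerivAt_id x).const_mul (-2 * (n : ℝ))).add
    (((hasDerivAt_besselSeries 0 _).comp x (hasDerivAt_sq_mul n x)).log hA.ne')
  convert! h.congr_of_eventuallyEq (Filter.Eventually.of_forall fun t => ?_) using 1
  · simp only [besselRatio, Function.comp_apply]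
    ring
  · rw [szaszK_eq, Real.log_mul (Real.exp_pos _).ne'
      (besselSeries_zero_pos (sq_nonneg _)).ne', Real.log_exp]
    rfl

lemma hasDerivAt_deriv_log_szaszK (n : ℕ) (x : ℝ) :
    HasDerivAt (fun t : ℝ => -2 * (n : ℝ) + 2 * n ^ 2 * t * besselRatio ((n * t) ^ 2))
      (2 * n ^ 2 * (2 - besselRatio ((n * x) ^ 2) -
        2 * (n * x) ^ 2 * besselRatio ((n * x) ^ 2) ^ 2)) x := by
  have hA := besselSeries_zero_pos (sq_nonneg ((n : ℝ) * x))
  have hr := ((hasDerivAt_besselSeries 1 _).div (hasDerivAt_besselSeries 0 _) hA.ne').comp x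
    (hasDerivAt_sq_mul n x)
  have h := (((hasDerivAt_id x).const_mul (2 * (n : ℝ) ^ 2)).mul hr).const_add (-2 * (n : ℝ))
  have hode := mul_besselSeries_two_add (((n : ℝ) * x) ^ 2)
  convert! h using 1
  simp only [besselRatio, Function.comp_apply, id, Pi.div_apply, zero_add, Nat.reduceAdd]
  generalize besselSeries 0 (((n : ℝ) * x) ^ 2) = a at hA hode ⊢
  generalize besselSeries 1 (((n : ℝ) * x) ^ 2) = b at hode ⊢
  generalize besselSeries 2 (((n : ℝ) * x) ^ 2) = c at hode ⊢
  have ha := hA.ne'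
  field_simp
  linear_combination (-2 * (n : ℝ) ^ 2 * a) * hode

/-- Convexity of `log K_n` gives a quadratic inequality for the logarithmic derivative. -/
lemma besselRatio_quadratic_le (n : ℕ) (hn : 0 < n)
    (hconv : ConvexOn ℝ (Ioi (0 : ℝ)) (fun x => Real.log (szaszK n x))) {x : ℝ} (hx : 0 < x) :
    2 * (n * x) ^ 2 * besselRatio ((n * x) ^ 2) ^ 2 + besselRatio ((n * x) ^ 2) ≤ 2 := by
  have hd : deriv (fun t => Real.log (szaszK n t)) =
      fun t : ℝ => -2 * (n : ℝ) + 2 * n ^ 2 * t * besselRatio ((n * t) ^ 2) :=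
    funext fun t => (hasDerivAt_log_szaszK n t).deriv
  have hm := hconv.monotoneOn_deriv
    fun t _ => (hasDerivAt_log_szaszK n t).differentiableAt
  rw [hd] at hm
  have h0 := hm.derivWithin_nonneg (x := x)
  rw [derivWithin_of_isOpen isOpen_Ioi hx, (hasDerivAt_deriv_log_szaszK n x).deriv] at h0
  have hn' : (0 : ℝ) < 2 * (n : ℝ) ^ 2 := by positivity
  have := nonneg_of_mul_nonneg_right h0 hn'
  linarith

lemma le_four_div_sqrt_add_one {y r : ℝ} (hy : 0 ≤ y) (h : 2 * y * r ^ 2 + r ≤ 2) :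
    r ≤ 4 / (Real.sqrt (1 + 16 * y) + 1) := by
  set S := Real.sqrt (1 + 16 * y) with hS
  have hS0 : 0 ≤ S := Real.sqrt_nonneg _
  have hS2 : S ^ 2 = 1 + 16 * y := Real.sq_sqrt (by positivity)
  by_contra! hlt
  have hq : 2 * y * (4 / (S + 1)) ^ 2 + 4 / (S + 1) = 2 := by
    have : y = (S ^ 2 - 1) / 16 := by linarith
    rw [this]
    field_simp
    ring
  have hsq : (4 / (S + 1)) ^ 2 ≤ r ^ 2 := by gcongr
  have := mul_le_mul_of_nonneg_left hsq (show 0 ≤ 2 * y by positivity)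
  linarith

lemma hasDerivAt_sqrt_sub_log (a x : ℝ) :
    HasDerivAt (fun t => Real.sqrt (1 + (a * t) ^ 2) - Real.log (Real.sqrt (1 + (a * t) ^ 2) + 1))
      (a ^ 2 * x / (Real.sqrt (1 + (a * x) ^ 2) + 1)) x := by
  have hpos : 0 < 1 + (a * x) ^ 2 := by positivity
  have hS := Real.sqrt_pos.mpr hpos
  have h := ((hasDerivAt_sq_mul a x).const_add 1).sqrt hpos.ne'
  convert! h.sub ((h.add_const 1).log (by positivity)) using 1
  field_simp
  ring

/-- If `log K_n` is convex on `(0,∞)`, then for every `x ≥ 0`,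
`K_n(x)² ≤ 2 exp(√(1+(4nx)²) - 1 - 4nx) / (√(1+(4nx)²) + 1)`. -/
theorem szaszK_sq_upper_bound (n : ℕ) (hn : 0 < n)
    (hconv : ConvexOn ℝ (Ioi (0 : ℝ)) (fun x => Real.log (szaszK n x))) :
    ∀ x : ℝ, 0 ≤ x →
      (szaszK n x) ^ 2 ≤
        2 * Real.exp (Real.sqrt (1 + (4 * n * x) ^ 2) - 1 - 4 * n * x)
          / (Real.sqrt (1 + (4 * n * x) ^ 2) + 1) := by
  intro x hx
  have hD (t : ℝ) := ((hasDerivAt_sqrt_sub_log (4 * n) t).sub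
    ((hasDerivAt_id t).const_mul (4 * (n : ℝ)))).sub ((hasDerivAt_log_szaszK n t).const_mul 2)
  have hmono := monotoneOn_of_deriv_nonneg (convex_Ici (0 : ℝ))
    (fun t _ => (hD t).continuousAt.continuousWithinAt)
    (fun t _ => (hD t).differentiableAt.differentiableWithinAt) (fun t ht => by
      rw [interior_Ici, mem_Ioi] at ht
      have hr := le_four_div_sqrt_add_one (sq_nonneg _) (besselRatio_quadratic_le n hn hconv ht)
      rw [show 16 * ((n : ℝ) * t) ^ 2 = (4 * n * t) ^ 2 by ring] at hr
      rw [(hD t).deriv]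
      have hnt : 0 ≤ 4 * (n : ℝ) ^ 2 * t := by positivity
      have := mul_nonneg hnt (sub_nonneg.mpr hr)
      convert! this using 1
      ring)
  have h := hmono self_mem_Ici hx hx
  have h0 : szaszK n 0 = 1 := by simp [szaszK_eq, besselSeries_zero_at_zero]
  simp only [Pi.sub_apply, id, mul_zero, h0, Real.log_one, ne_eq, OfNat.ofNat_ne_zero,
    not_false_eq_true, zero_pow, add_zero, Real.sqrt_one, sub_zero] at h
  rw [one_add_one_eq_two] at h
  have hS : 0 < Real.sqrt (1 + (4 * n * x) ^ 2) + 1 := by positivity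
  rw [← Real.log_le_log_iff (pow_pos (szaszK_pos n x) 2) (by positivity), Real.log_pow,
    Real.log_div (by positivity) hS.ne', Real.log_mul two_ne_zero (Real.exp_pos _).ne',
    Real.log_exp]
  push_cast
  linarith
end

section
/- For every $x \ge 0$, $I_0(x) \le \frac{e^x}{\sqrt{2x+1}}$. -/
open Real

/-- `I₀ x = ∑_{k≥0} (x/2)^{2k}/(k!)²`, the modified Bessel function of the first kind
of order zero. -/
noncomputable def besselI0 (x : ℝ) : ℝ :=
  ∑' k : ℕ, (x / 2) ^ (2 * k) / (Nat.factorial k : ℝ) ^ 2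

/-- The Bessel–Clifford series `∑_{k≥0} z^k / (k! (k+m)!)`. -/
noncomputable def besselClifford (m : ℕ) (z : ℝ) : ℝ :=
  ∑' k : ℕ, z ^ k / (k.factorial * (k + m).factorial : ℝ)

theorem summable_besselClifford (m : ℕ) (z : ℝ) :
    Summable fun k : ℕ => z ^ k / (k.factorial * (k + m).factorial : ℝ) := by
  refine (Real.summable_pow_div_factorial |z|).of_norm_bounded fun k => ?_
  rw [norm_div, norm_pow, norm_mul, Real.norm_natCast, Real.norm_natCast, Real.norm_eq_abs]
  have h : (1 : ℝ) ≤ (k + m).factorial := by exact_mod_cast Nat.one_le_iff_ne_zero.2 (Nat.factorial_ne_zero _)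
  gcongr
  exact le_mul_of_one_le_right (by positivity) h

theorem besselClifford_nonneg (m : ℕ) {z : ℝ} (hz : 0 ≤ z) : 0 ≤ besselClifford m z :=
  tsum_nonneg fun _ => by positivity

theorem hasDerivAt_besselClifford (m : ℕ) (z : ℝ) :
    HasDerivAt (besselClifford m) (besselClifford (m + 1) z) z := by
  set g' : ℕ → ℝ → ℝ := fun k y =>
    k * y ^ (k - 1) / (k.factorial * (k + m).factorial : ℝ) with hg'
  have hsucc (k : ℕ) (y : ℝ) :
      g' (k + 1) y = y ^ k / (k.factorial * (k + (m + 1)).factorial : ℝ) := by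
    have e : k + 1 + m = k + (m + 1) := by ring
    simp only [hg', e, Nat.factorial_succ k, Nat.add_sub_cancel]
    push_cast
    field_simp
  set R := |z| + 1
  have hu : Summable fun k => g' k R :=
    (summable_nat_add_iff 1).1 (by simpa only [hsucc] using summable_besselClifford (m + 1) R)
  have hz : z ∈ Metric.ball (0 : ℝ) R := by simp [R]
  have key := hasDerivAt_tsum_of_isPreconnected
    (g := fun (k : ℕ) y => y ^ k / (k.factorial * (k + m).factorial : ℝ)) (g' := g') hu
    Metric.isOpen_ball (convex_ball (0 : ℝ) R).isPreconnected
    (fun k y _ => (hasDerivAt_pow k y).div_const _)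
    (fun k y hy => by
      have hy' : |y| ≤ R := by simpa using (Metric.mem_ball.1 hy).le
      simp only [hg', norm_div, norm_mul, norm_pow, Real.norm_natCast, Real.norm_eq_abs y]
      gcongr)
    hz (summable_besselClifford m z) hz
  have hs : Summable fun k => g' k z :=
    (summable_nat_add_iff 1).1 (by simpa only [hsucc] using summable_besselClifford (m + 1) z)
  have e : ∑' k, g' k z = besselClifford (m + 1) z := by
    rw [hs.tsum_eq_zero_add]
    simp only [hsucc]
    simp [besselClifford, hg']
  rwa [e] at key

theorem besselClifford_recurrence (z : ℝ) :
    z * besselClifford 2 z + besselClifford 1 z = besselClifford 0 z := by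
  have h0 := summable_besselClifford 0 z
  have h1 := summable_besselClifford 1 z
  have h2 := (summable_besselClifford 2 z).mul_left z
  simp only [besselClifford]
  rw [h0.tsum_eq_zero_add, h1.tsum_eq_zero_add, ← tsum_mul_left, add_left_comm,
    ← h2.tsum_add ((summable_nat_add_iff 1).2 h1)]
  congr 1
  refine tsum_congr fun k => ?_
  simp only [add_zero, Nat.factorial_succ]
  push_cast
  field_simp
  ring

theorem besselI0_eq_besselClifford (x : ℝ) : besselI0 x = besselClifford 0 (x ^ 2 / 4) := by
  refine tsum_congr fun k => ?_
  rw [pow_mul, div_pow]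
  norm_num [sq]

theorem hasDerivAt_besselClifford_sq_div_four (m : ℕ) (x : ℝ) :
    HasDerivAt (fun x : ℝ => besselClifford m (x ^ 2 / 4))
      (besselClifford (m + 1) (x ^ 2 / 4) * (x / 2)) x := by
  have h : HasDerivAt (fun x : ℝ => x ^ 2 / 4) (x / 2) x := by
    refine ((hasDerivAt_pow 2 x).div_const 4).congr_deriv ?_
    norm_num
    ring
  exact (hasDerivAt_besselClifford m (x ^ 2 / 4)).comp x h

/-- The bound `I₁(x) / I₀(x) ≤ 2x / (1 + 2x)`, with `I₁(x) = (x/2) besselClifford 1 (x²/4)`. -/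
theorem besselClifford_one_le {x : ℝ} (hx : 0 < x) :
    (1 + 2 * x) / 2 * besselClifford 1 (x ^ 2 / 4) ≤ 2 * besselClifford 0 (x ^ 2 / 4) := by
  set q : ℝ → ℝ := fun x =>
    (1 + 2 * x) / 2 * besselClifford 1 (x ^ 2 / 4) - 2 * besselClifford 0 (x ^ 2 / 4) with hq
  have hq' (y : ℝ) : HasDerivAt q (besselClifford 1 (y ^ 2 / 4) +
      (1 + 2 * y) / 2 * (besselClifford 2 (y ^ 2 / 4) * (y / 2)) -
      2 * (besselClifford 1 (y ^ 2 / 4) * (y / 2))) y := by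
    have h : HasDerivAt (fun y : ℝ => (1 + 2 * y) / 2) 1 y := by
      refine ((((hasDerivAt_id y).const_mul 2).const_add 1).div_const 2).congr_deriv ?_
      norm_num
    refine ((h.mul (hasDerivAt_besselClifford_sq_div_four 1 y)).sub
      ((hasDerivAt_besselClifford_sq_div_four 0 y).const_mul 2)).congr_deriv ?_
    ring
  have hqc : Continuous q := continuous_iff_continuousAt.2 fun y => (hq' y).continuousAt
  have hanti : AntitoneOn (fun y => √y * (exp y * q y)) (Set.Ici 0) := by
    refine antitoneOn_of_hasDerivWithinAt_nonpos (convex_Ici 0)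
      (by fun_prop) (f' := fun y => exp y / √y * (-(3 / 4) * besselClifford 1 (y ^ 2 / 4))) ?_ ?_
    · intro y hy
      rw [interior_Ici, Set.mem_Ioi] at hy
      have hs : 0 < √y := sqrt_pos.2 hy
      have hss : √y ^ 2 = y := sq_sqrt hy.le
      refine HasDerivAt.hasDerivWithinAt
        (((hasDerivAt_sqrt hy.ne').mul ((hasDerivAt_exp y).mul (hq' y))).congr_deriv ?_)
      have hr := besselClifford_recurrence (y ^ 2 / 4)
      simp only [hq, Pi.mul_apply]
      field_simp
      rw [hss]
      linear_combination (16 * (1 + 2 * y)) * hr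
    · intro y _
      have := besselClifford_nonneg 1 (z := y ^ 2 / 4) (by positivity)
      exact mul_nonpos_of_nonneg_of_nonpos (by positivity) (by linarith)
  have h := hanti Set.self_mem_Ici (Set.mem_Ici.2 hx.le) hx.le
  simp only [sqrt_zero, zero_mul] at h
  rw [← mul_assoc] at h
  have : q x ≤ 0 := nonpos_of_mul_nonpos_right h (mul_pos (sqrt_pos.2 hx) (exp_pos x))
  exact sub_nonpos.1 this

theorem antitoneOn_besselClifford_sq_mul :
    AntitoneOn (fun x : ℝ => besselClifford 0 (x ^ 2 / 4) ^ 2 * (exp (-2 * x) * (2 * x + 1)))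
      (Set.Ici 0) := by
  have hd (x : ℝ) : HasDerivAt
      (fun x : ℝ => besselClifford 0 (x ^ 2 / 4) ^ 2 * (exp (-2 * x) * (2 * x + 1)))
      (2 * x * besselClifford 0 (x ^ 2 / 4) * exp (-2 * x) *
        ((1 + 2 * x) / 2 * besselClifford 1 (x ^ 2 / 4) - 2 * besselClifford 0 (x ^ 2 / 4))) x := by
    have he : HasDerivAt (fun x : ℝ => exp (-2 * x)) (exp (-2 * x) * (-2 * 1)) x :=
      ((hasDerivAt_id x).const_mul (-2)).exp
    have hl : HasDerivAt (fun x : ℝ => 2 * x + 1) (2 * 1) x :=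
      ((hasDerivAt_id x).const_mul 2).add_const 1
    refine (((hasDerivAt_besselClifford_sq_div_four 0 x).pow 2).mul (he.mul hl)).congr_deriv ?_
    simp only [Pi.mul_apply, Pi.pow_apply]
    ring
  refine antitoneOn_of_hasDerivWithinAt_nonpos (convex_Ici 0)
    (fun x _ => (hd x).continuousAt.continuousWithinAt) (fun x _ => (hd x).hasDerivWithinAt) ?_
  intro x hx
  rw [interior_Ici, Set.mem_Ioi] at hx
  have := besselClifford_nonneg 0 (z := x ^ 2 / 4) (by positivity)
  exact mul_nonpos_of_nonneg_of_nonpos (by positivity) (sub_nonpos.2 (besselClifford_one_le hx))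

/-- For every `x ≥ 0`, `I₀(x) ≤ eˣ / √(2x+1)`. -/
theorem besselI0_le_exp_div_sqrt :
    ∀ x : ℝ, 0 ≤ x → besselI0 x ≤ Real.exp x / Real.sqrt (2 * x + 1) := by
  intro x hx
  have h := antitoneOn_besselClifford_sq_mul Set.self_mem_Ici (Set.mem_Ici.2 hx) hx
  have h0 : besselClifford 0 0 = 1 := by simpa using (besselClifford_recurrence 0).symm.trans (by
    rw [zero_mul, zero_add, besselClifford, tsum_eq_single 0 (by intro k hk; simp [hk])]; simp)
  simp only [← besselI0_eq_besselClifford] at h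
  rw [besselI0_eq_besselClifford 0] at h
  norm_num [h0] at h
  rw [le_div_iff₀ (sqrt_pos.2 (by positivity))]
  refine le_of_pow_le_pow_left₀ two_ne_zero (exp_pos x).le ?_
  rw [mul_pow, sq_sqrt (by positivity)]
  have he : exp (-(2 * x)) * exp x ^ 2 = 1 := by
    rw [← exp_nat_mul, ← exp_add]
    simp
  calc besselI0 x ^ 2 * (2 * x + 1)
      = besselI0 x ^ 2 * (exp (-(2 * x)) * (2 * x + 1)) * exp x ^ 2 := by
        linear_combination (-(besselI0 x ^ 2 * (2 * x + 1))) * he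
    _ ≤ 1 * exp x ^ 2 := by gcongr
    _ = exp x ^ 2 := one_mul _
end

section
/- Let $n$ be a positive integer. For every $x \in [0,1/2]$, $-\frac{2n(1-2x)}{1+(n-3)x(1-x)} \le \frac{F_n'(x)}{F_n(x)}$. -/
open Real Set

/-- `F n x = ∑_{k=0}^n C(n,k)² x^{2k} (1-x)^{2(n-k)}`, the sum of the squares of the
Bernstein basis polynomials. -/
noncomputable def bernsteinF (n : ℕ) (x : ℝ) : ℝ :=
  ∑ k ∈ Finset.range (n + 1),
    (Nat.choose n k : ℝ) ^ 2 * x ^ (2 * k) * (1 - x) ^ (2 * (n - k))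

open Polynomial in
/-- The polynomial whose evaluation is `bernsteinF n`. -/
noncomputable def bernsteinFPoly (n : ℕ) : ℝ[X] :=
  ∑ k ∈ Finset.range (n + 1),
    C ((Nat.choose n k : ℝ) ^ 2) * X ^ (2 * k) * (1 - X) ^ (2 * (n - k))

lemma eval_bernsteinFPoly (n : ℕ) (x : ℝ) : (bernsteinFPoly n).eval x = bernsteinF n x := by
  simp [bernsteinFPoly, bernsteinF, Polynomial.eval_finsetSum]

lemma deriv_bernsteinF (n : ℕ) (x : ℝ) :
    deriv (bernsteinF n) x = (bernsteinFPoly n).derivative.eval x := by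
  rw [← Polynomial.deriv]
  exact congrArg (deriv · x) (funext fun y => (eval_bernsteinFPoly n y).symm)

open Polynomial in
lemma X_mul_derivative_X_pow (m : ℕ) :
    (X : ℝ[X]) * derivative (X ^ m : ℝ[X]) = (m : ℝ[X]) * X ^ m := by
  cases m with
  | zero => simp
  | succ m => simp [derivative_X_pow_succ]; ring

open Polynomial in
lemma one_sub_X_mul_derivative_pow (m : ℕ) :
    (1 - X : ℝ[X]) * derivative ((1 - X) ^ m : ℝ[X]) = -((m : ℝ[X]) * (1 - X) ^ m) := by
  cases m with
  | zero => simp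
  | succ m =>
    simp only [derivative_pow_succ, derivative_sub, derivative_one, derivative_X, map_add,
      map_natCast, map_one]
    push_cast
    ring

open Polynomial in
/-- The differential operator annihilating `bernsteinFPoly n`. -/
noncomputable def bernsteinFOperator (n : ℕ) : ℝ[X] →ₗ[ℝ] ℝ[X] :=
  LinearMap.mulLeft ℝ (X * (1 - X) * (1 - 2 * X)) ∘ₗ derivative ∘ₗ derivative
    + LinearMap.mulLeft ℝ (1 + 4 * ((n : ℝ[X]) - 1) * (X * (1 - X))) ∘ₗ derivative
    + LinearMap.mulLeft ℝ (2 * (n : ℝ[X]) * (1 - 2 * X))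

open Polynomial in
lemma bernsteinFOperator_apply (n : ℕ) (f : ℝ[X]) :
    bernsteinFOperator n f =
      X * (1 - X) * (1 - 2 * X) * derivative (derivative f)
        + (1 + 4 * ((n : ℝ[X]) - 1) * (X * (1 - X))) * derivative f
        + 2 * (n : ℝ[X]) * (1 - 2 * X) * f := rfl

open Polynomial in
lemma mul_bernsteinFOperator_monomial (c : ℝ) (k j : ℕ) :
    X * (1 - X) * bernsteinFOperator (k + j) (C c * X ^ (2 * k) * (1 - X) ^ (2 * j)) =
      4 * ((k : ℝ[X]) ^ 2 * (1 - X) ^ 2 - (j : ℝ[X]) ^ 2 * X ^ 2)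
        * (C c * X ^ (2 * k) * (1 - X) ^ (2 * j)) := by
  rw [bernsteinFOperator_apply]
  set T : ℝ[X] := C c * X ^ (2 * k) * (1 - X) ^ (2 * j) with hT
  have h1 : X * (1 - X) * derivative T = (2 * (k : ℝ[X]) * (1 - X) - 2 * (j : ℝ[X]) * X) * T := by
    have hx := X_mul_derivative_X_pow (2 * k)
    have hy := one_sub_X_mul_derivative_pow (2 * j)
    push_cast at hx hy
    rw [hT, derivative_mul, derivative_mul, derivative_C]
    linear_combination C c * (1 - X) * (1 - X) ^ (2 * j) * hx + C c * X * X ^ (2 * k) * hy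
  have h2 := congrArg derivative h1
  simp only [derivative_mul, derivative_sub, derivative_X, derivative_one, derivative_natCast,
    derivative_ofNat] at h2
  push_cast
  linear_combination (1 - 2 * X) * X * (1 - X) * h2 +
    ((1 - 2 * X) * (2 * (k : ℝ[X]) * (1 - X) - 2 * (j : ℝ[X]) * X - (1 - 2 * X))
      + (1 + 4 * ((k : ℝ[X]) + j - 1) * (X * (1 - X)))) * h1

open Polynomial in
lemma bernsteinFOperator_bernsteinFPoly (n : ℕ) :
    bernsteinFOperator n (bernsteinFPoly n) = 0 := by
  have hX : (X : ℝ[X]) * (1 - X) ≠ 0 := by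
    refine mul_ne_zero X_ne_zero fun h => ?_
    simpa using congrArg (eval 0) h
  refine (mul_eq_zero.mp ?_).resolve_left hX
  have hterm : ∀ k ∈ Finset.range (n + 1),
      X * (1 - X) * bernsteinFOperator n
          (C ((Nat.choose n k : ℝ) ^ 2) * X ^ (2 * k) * (1 - X) ^ (2 * (n - k))) =
        4 * (((Nat.choose n k * k : ℕ) : ℝ[X]) ^ 2 * X ^ (2 * k) * (1 - X) ^ (2 * (n + 1 - k)))
        - 4 * (((Nat.choose n k * (n - k) : ℕ) : ℝ[X]) ^ 2 * X ^ (2 * (k + 1))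
            * (1 - X) ^ (2 * (n - k))) := by
    intro k hk
    obtain ⟨j, rfl⟩ := Nat.exists_eq_add_of_le (Nat.lt_succ_iff.mp (Finset.mem_range.mp hk))
    have hj : k + j - k = j := by omega
    have hj' : k + j + 1 - k = j + 1 := by omega
    rw [hj, hj', mul_bernsteinFOperator_monomial]
    push_cast
    simp only [map_pow, map_natCast]
    ring
  rw [bernsteinFPoly, map_sum, Finset.mul_sum, Finset.sum_congr rfl hterm,
    Finset.sum_sub_distrib, Finset.sum_range_succ', Finset.sum_range_succ (n := n)]
  simp [Nat.choose_succ_right_eq]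

/-- A minimum principle for first-order differential inequalities whose leading coefficient
vanishes at the left endpoint. -/
lemma nonneg_of_mul_deriv_add_mul_nonneg {a b : ℝ} {f f' p q : ℝ → ℝ}
    (hf : ∀ x ∈ Icc a b, HasDerivAt f (f' x) x) (hpa : p a = 0)
    (hp : ∀ x ∈ Icc a b, 0 ≤ p x) (hq : ∀ x ∈ Icc a b, 0 < q x)
    (h : ∀ x ∈ Icc a b, 0 ≤ p x * f' x + q x * f x) :
    ∀ x ∈ Icc a b, 0 ≤ f x := by
  intro x hx
  obtain ⟨m, hm, hmin⟩ := isCompact_Icc.exists_isMinOn ⟨x, hx⟩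
    (fun y hy => (hf y hy).continuousAt.continuousWithinAt)
  refine le_trans ?_ (hmin hx)
  have hle : p m * f' m ≤ 0 := by
    rcases eq_or_lt_of_le hm.1 with rfl | ham
    · simp [hpa]
    · have hcone : a - m ∈ posTangentConeAt (Icc a b) m :=
        sub_mem_posTangentConeAt_of_segment_subset
          ((convex_Icc a b).segment_subset hm ⟨le_rfl, hm.1.trans hm.2⟩)
      have := hmin.localize.hasFDerivWithinAt_nonneg
        (hf m hm).hasFDerivAt.hasFDerivWithinAt hcone
      simp at this
      exact mul_nonpos_of_nonneg_of_nonpos (hp m hm) (by nlinarith)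
  exact nonneg_of_mul_nonneg_right (by linarith [h m hm]) (hq m hm)

lemma bernsteinF_pos (n : ℕ) {x : ℝ} (hx : x ∈ Icc (0 : ℝ) (1 / 2)) : 0 < bernsteinF n x := by
  have hx1 : 0 < 1 - x := by linarith [hx.2]
  have hx0 := hx.1
  refine Finset.sum_pos' (fun k _ => by positivity) ⟨0, by simp, ?_⟩
  rw [Nat.choose_zero_right, Nat.cast_one, mul_zero, pow_zero]
  positivity

/-- For every positive integer `n` and every `x ∈ [0,1/2]`,
`-2n(1-2x)/(1+(n-3)x(1-x)) ≤ F_n'(x)/F_n(x)`. -/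
theorem bernsteinF_logderiv_lower_bound (n : ℕ) (hn : 0 < n) :
    ∀ x ∈ Icc (0 : ℝ) (1 / 2),
      -(2 * n * (1 - 2 * x)) / (1 + ((n : ℝ) - 3) * (x * (1 - x)))
        ≤ deriv (bernsteinF n) x / bernsteinF n x := by
  have hn1 : (1 : ℝ) ≤ n := by exact_mod_cast hn
  set F : ℝ → ℝ := fun x => (bernsteinFPoly n).eval x
  set F' : ℝ → ℝ := fun x => (bernsteinFPoly n).derivative.eval x
  set F'' : ℝ → ℝ := fun x => (bernsteinFPoly n).derivative.derivative.eval x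
  have hF : ∀ x, HasDerivAt F (F' x) x := fun x => Polynomial.hasDerivAt _ x
  have hF' : ∀ x, HasDerivAt F' (F'' x) x := fun x => Polynomial.hasDerivAt _ x
  have hode : ∀ x, x * (1 - x) * (1 - 2 * x) * F'' x
      + (1 + 4 * ((n : ℝ) - 1) * (x * (1 - x))) * F' x + 2 * n * (1 - 2 * x) * F x = 0 := by
    intro x
    have := congrArg (Polynomial.eval x) (bernsteinFOperator_bernsteinFPoly n)
    simpa [bernsteinFOperator_apply] using this
  have hFpos : ∀ x ∈ Icc (0 : ℝ) (1 / 2), 0 < F x := fun x hx =>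
    (bernsteinF_pos n hx).trans_eq (eval_bernsteinFPoly n x).symm
  have hX : ∀ x ∈ Icc (0 : ℝ) (1 / 2), 0 ≤ x * (1 - x) := fun x hx =>
    mul_nonneg hx.1 (by linarith [hx.2])
  have hs : ∀ x ∈ Icc (0 : ℝ) (1 / 2), 0 ≤ 1 - 2 * x := fun x hx => by linarith [hx.2]
  have hA : ∀ x ∈ Icc (0 : ℝ) (1 / 2), 0 < 1 + ((n : ℝ) - 3) * (x * (1 - x)) := fun x hx => by
    nlinarith [mul_nonneg (sub_nonneg.mpr hn1) (hX x hx), sq_nonneg (1 - 2 * x)]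
  have hlead : ∀ x ∈ Icc (0 : ℝ) (1 / 2), 0 ≤ x * (1 - x) * (1 - 2 * x) := fun x hx =>
    mul_nonneg (hX x hx) (hs x hx)
  have hF'nonpos : ∀ x ∈ Icc (0 : ℝ) (1 / 2), 0 ≤ -F' x := by
    refine nonneg_of_mul_deriv_add_mul_nonneg (fun x _ => (hF' x).neg)
      (p := fun x => x * (1 - x) * (1 - 2 * x))
      (q := fun x => 1 + 4 * ((n : ℝ) - 1) * (x * (1 - x))) (by simp) hlead
      (fun x hx => ?_) (fun x hx => ?_)
    · nlinarith [mul_nonneg (sub_nonneg.mpr hn1) (hX x hx)]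
    · have := mul_nonneg (mul_nonneg (by positivity : (0 : ℝ) ≤ 2 * n) (hs x hx)) (hFpos x hx).le
      linarith [hode x]
  have hH : ∀ x ∈ Icc (0 : ℝ) (1 / 2),
      0 ≤ (1 + ((n : ℝ) - 3) * (x * (1 - x))) * F' x + 2 * n * (1 - 2 * x) * F x := by
    refine nonneg_of_mul_deriv_add_mul_nonneg
      (f' := fun x => ((n : ℝ) - 3) * (1 - 2 * x) * F' x
        + (1 + ((n : ℝ) - 3) * (x * (1 - x))) * F'' x + (-(4 * n) * F x
        + 2 * n * (1 - 2 * x) * F' x))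
      (p := fun x => x * (1 - x) * (1 - 2 * x))
      (q := fun x => 1 + ((n : ℝ) - 3) * (x * (1 - x)) + 2 * (x * (1 - x)))
      (fun x _ => ?_) (by simp) hlead (fun x hx => ?_) (fun x hx => ?_)
    · have hx := hasDerivAt_id' x
      have hcoef := ((hx.mul (hx.const_sub 1)).const_mul ((n : ℝ) - 3)).const_add 1
      have hlin := ((hx.const_mul 2).const_sub 1).const_mul (2 * (n : ℝ))
      refine ((hcoef.mul (hF' x)).add (hlin.mul (hF x))).congr_deriv ?_
      simp only [Pi.mul_apply]
      ring
    · linarith [hA x hx, hX x hx]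
    · have hrem : 0 ≤ 3 * ((n : ℝ) - 1) * (n + 1) * (x * (1 - x)) ^ 2 * -F' x :=
        mul_nonneg (mul_nonneg (mul_nonneg (by linarith) (by linarith)) (sq_nonneg _))
          (hF'nonpos x hx)
      refine hrem.trans_eq ?_
      linear_combination -(1 + ((n : ℝ) - 3) * (x * (1 - x))) * hode x
  intro x hx
  rw [deriv_bernsteinF, ← eval_bernsteinFPoly, div_le_div_iff₀ (hA x hx) (hFpos x hx)]
  linarith [hH x hx]
end

section
/- Let $n \ge 2$ be an integer. For every $t \ge 1$, $P_n(t) \le \left(t+\sqrt{t^2-1}\right)^{\frac{n(2n^2-1)}{2n^2-n-2}}\left(t+\frac{2n^2-1}{n+1}\sqrt{t^2-1}\right)^{-\frac{n(n+1)}{2n^2-n-2}}$. -/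
open Real Polynomial

/-- The `n`-th Legendre polynomial, via the Rodrigues formula
`P_n = (1/(2ⁿ n!)) dⁿ/dtⁿ [(t²-1)ⁿ]`. -/
noncomputable def legendreP (n : ℕ) : Polynomial ℝ :=
  (1 / (2 ^ n * (Nat.factorial n : ℝ))) •
    (fun q : Polynomial ℝ => Polynomial.derivative q)^[n] ((X ^ 2 - 1) ^ n)

theorem iterate_derivative_X_sq_sub_one_pow_ode (n k : ℕ) :
    (X ^ 2 - 1 : ℝ[X]) * derivative^[k + 2] ((X ^ 2 - 1) ^ n)
      + 2 * ((k : ℝ[X]) + 1) * X * derivative^[k + 1] ((X ^ 2 - 1) ^ n)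
      + (k : ℝ[X]) * ((k : ℝ[X]) + 1) * derivative^[k] ((X ^ 2 - 1) ^ n)
      = 2 * (n : ℝ[X]) * (X * derivative^[k + 1] ((X ^ 2 - 1) ^ n)
        + ((k : ℝ[X]) + 1) * derivative^[k] ((X ^ 2 - 1) ^ n)) := by
  induction k with
  | zero =>
    have h : (X ^ 2 - 1 : ℝ[X]) * derivative ((X ^ 2 - 1) ^ n)
        = 2 * (n : ℝ[X]) * (X * (X ^ 2 - 1) ^ n) := by
      cases n with
      | zero => simp
      | succ m =>
        simp only [derivative_pow_succ, derivative_sub, derivative_X, derivative_one, map_add,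
          map_natCast, map_one]
        push_cast
        ring
    have h' := congrArg derivative h
    simp only [derivative_mul, derivative_sub, derivative_X_pow, derivative_one,
      derivative_natCast, derivative_ofNat, derivative_X, map_natCast] at h'
    simp only [Function.iterate_succ_apply', Function.iterate_zero_apply]
    push_cast at h' ⊢
    linear_combination h'
  | succ k ih =>
    have h' := congrArg derivative ih
    simp only [derivative_mul, derivative_add, derivative_sub, derivative_X_pow, derivative_one,
      derivative_natCast, derivative_ofNat, derivative_X, map_natCast] at h'
    simp only [← Function.iterate_succ_apply' derivative, Nat.succ_eq_add_one] at h'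
    push_cast at h' ⊢
    simp only [show k + 1 + 2 = k + 2 + 1 from rfl, show k + 2 = k + 1 + 1 from rfl] at h' ⊢
    linear_combination h'

theorem legendreP_eq (n : ℕ) :
    legendreP n = C (1 / (2 ^ n * (n.factorial : ℝ))) * derivative^[n] ((X ^ 2 - 1) ^ n) := by
  rw [legendreP, smul_eq_C_mul]

theorem legendreP_ode (n : ℕ) (t : ℝ) :
    (t ^ 2 - 1) * (derivative (derivative (legendreP n))).eval t
      + 2 * t * (derivative (legendreP n)).eval t = n * (n + 1) * (legendreP n).eval t := by
  have h := congrArg (eval t) (iterate_derivative_X_sq_sub_one_pow_ode n n)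
  rw [legendreP_eq]
  simp only [derivative_C_mul, ← Function.iterate_succ_apply' derivative, Nat.succ_eq_add_one,
    eval_mul, eval_add, eval_sub, eval_pow, eval_X, eval_C, eval_one, eval_natCast,
    eval_ofNat] at h ⊢
  linear_combination (1 / (2 ^ n * (n.factorial : ℝ))) * h

theorem legendreP_eval_eq_sum (n : ℕ) (t : ℝ) :
    (legendreP n).eval t = 1 / (2 ^ n * (n.factorial : ℝ)) *
      ∑ k ∈ Finset.range (n + 1), (n.choose k : ℝ) *
        ((n.descFactorial (n - k) * (t - 1) ^ (n - (n - k))) *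
          (n.descFactorial k * (t + 1) ^ (n - k))) := by
  have h : (X ^ 2 - 1 : ℝ[X]) ^ n = (X - C 1) ^ n * (X + C 1) ^ n := by
    rw [← mul_pow, map_one]; ring
  rw [legendreP_eq, h, iterate_derivative_mul]
  simp [-map_one, eval_finsetSum, iterate_derivative_X_sub_pow, iterate_derivative_X_add_pow]

theorem legendreP_eval_nonneg (n : ℕ) {t : ℝ} (ht : 1 ≤ t) : 0 ≤ (legendreP n).eval t := by
  have h : 0 ≤ t - 1 := by linarith
  rw [legendreP_eval_eq_sum]
  positivity

theorem legendreP_eval_one (n : ℕ) : (legendreP n).eval 1 = 1 := by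
  rw [legendreP_eval_eq_sum, Finset.sum_eq_single_of_mem 0 (by simp)]
  · have := n.factorial_pos
    simp [Nat.descFactorial_self]
    norm_num
    field_simp
  · intro k hk hk0
    have : n - (n - k) ≠ 0 := by grind
    simp [this]

/-- The function `θ ↦ n²(2n+1) sinh θ / ((n+1) cosh θ + (2n²-1) sinh θ)` is a supersolution of the
Riccati equation satisfied by the logarithmic derivative of `θ ↦ P_n (cosh θ)`. -/
theorem legendre_riccati_supersolution {x c s : ℝ} (hx : 1 ≤ x) (hs : 0 ≤ s) (hc : 0 < c)
    (hcs : c ^ 2 - s ^ 2 = 1) :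
    x * (x + 1) ≤ x ^ 2 * (2 * x + 1) * (x + 1) / ((x + 1) * c + (2 * x ^ 2 - 1) * s) ^ 2
      + x ^ 2 * (2 * x + 1) * c / ((x + 1) * c + (2 * x ^ 2 - 1) * s)
      + (x ^ 2 * (2 * x + 1) * s / ((x + 1) * c + (2 * x ^ 2 - 1) * s)) ^ 2 := by
  have hb : 0 < 2 * x ^ 2 - 1 := by nlinarith
  have hD : 0 < (x + 1) * c + (2 * x ^ 2 - 1) * s := by positivity
  set D := (x + 1) * c + (2 * x ^ 2 - 1) * s with hDdef
  have e : x ^ 2 * (2 * x + 1) * (x + 1) / D ^ 2 + x ^ 2 * (2 * x + 1) * c / D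
      + (x ^ 2 * (2 * x + 1) * s / D) ^ 2
      = (x ^ 2 * (2 * x + 1) * (x + 1) + x ^ 2 * (2 * x + 1) * c * D
        + (x ^ 2 * (2 * x + 1) * s) ^ 2) / D ^ 2 := by
    field_simp
  rw [e, le_div_iff₀ (by positivity)]
  have h1 : 0 ≤ 1 + 2 * s ^ 2 - 2 * (c * s) := by nlinarith [sq_nonneg (c - s)]
  have h2 : 0 ≤ x * (2 * x ^ 2 - 1) * (3 * x + 2) * (1 + 2 * s ^ 2 - 2 * (c * s)) := by positivity
  have h3 : 0 ≤ x * (2 * x ^ 2 + x) := by positivity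
  have hc2 : c ^ 2 = 1 + s ^ 2 := by linarith
  rw [hDdef]
  have key : 2 * (x ^ 2 * (2 * x + 1) * (x + 1)
        + x ^ 2 * (2 * x + 1) * c * ((x + 1) * c + (2 * x ^ 2 - 1) * s)
        + (x ^ 2 * (2 * x + 1) * s) ^ 2)
      - 2 * (x * (x + 1) * ((x + 1) * c + (2 * x ^ 2 - 1) * s) ^ 2)
      = x * (2 * x ^ 2 - 1) * (3 * x + 2) * (1 + 2 * s ^ 2 - 2 * (c * s))
        + x * (2 * x ^ 2 + x) := by
    linear_combination (2 * x ^ 2 * (2 * x + 1) * (x + 1) - 2 * x * (x + 1) ^ 3) * hc2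
  linarith

/-- If `B' = ψ B` with `B > 0`, `B 0 = 1`, and `ψ` is a supersolution of the Riccati equation
attached to the Legendre equation, then `P_n (cosh θ) ≤ B θ`. -/
theorem legendreP_eval_cosh_le (n : ℕ) {B ψ ψ' : ℝ → ℝ}
    (hB : ∀ θ, 0 ≤ θ → HasDerivAt B (ψ θ * B θ) θ) (hBpos : ∀ θ, 0 ≤ θ → 0 < B θ) (hB0 : B 0 = 1)
    (hψ : ∀ θ, 0 ≤ θ → HasDerivAt ψ (ψ' θ) θ)
    (hsup : ∀ θ, 0 ≤ θ → n * (n + 1) * Real.sinh θ ≤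
      Real.sinh θ * ψ' θ + Real.cosh θ * ψ θ + Real.sinh θ * ψ θ ^ 2)
    {θ : ℝ} (hθ : 0 ≤ θ) : (legendreP n).eval (Real.cosh θ) ≤ B θ := by
  have hy (p : ℝ[X]) (θ : ℝ) : HasDerivAt (fun θ => p.eval (Real.cosh θ))
      ((derivative p).eval (Real.cosh θ) * Real.sinh θ) θ :=
    (p.hasDerivAt _).comp θ (Real.hasDerivAt_cosh θ)
  set P := legendreP n
  set v : ℝ → ℝ := fun θ => (derivative P).eval (Real.cosh θ) * Real.sinh θ
    - ψ θ * P.eval (Real.cosh θ) with hv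
  have hF (θ : ℝ) (h0 : 0 ≤ θ) : HasDerivAt (fun θ => Real.sinh θ * B θ * v θ)
      (B θ * P.eval (Real.cosh θ) * (n * (n + 1) * Real.sinh θ - (Real.sinh θ * ψ' θ
        + Real.cosh θ * ψ θ + Real.sinh θ * ψ θ ^ 2))) θ := by
    have := ((Real.hasDerivAt_sinh θ).mul (hB θ h0)).mul
      (((hy (derivative P) θ).mul (Real.hasDerivAt_sinh θ)).sub ((hψ θ h0).mul (hy P θ)))
    refine this.congr_deriv ?_
    have ode := legendreP_ode n (Real.cosh θ)
    rw [Real.cosh_sq θ, add_sub_cancel_right] at ode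
    simp only [Pi.mul_apply, Pi.sub_apply]
    linear_combination (Real.sinh θ * B θ) * ode
  have hFanti : AntitoneOn (fun θ => Real.sinh θ * B θ * v θ) (Set.Ici 0) := by
    refine antitoneOn_of_hasDerivWithinAt_nonpos (convex_Ici 0)
      (fun θ h => (hF θ h).continuousAt.continuousWithinAt)
      (fun θ h => (hF θ (interior_subset h)).hasDerivWithinAt) fun θ h => ?_
    have h0 : 0 ≤ θ := interior_subset h
    exact mul_nonpos_of_nonneg_of_nonpos
      (mul_nonneg (hBpos θ h0).le (legendreP_eval_nonneg n (Real.one_le_cosh θ)))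
      (by linarith [hsup θ h0])
  have hv0 (θ : ℝ) (h0 : 0 < θ) : v θ ≤ 0 := by
    have h := hFanti Set.self_mem_Ici h0.le h0.le
    simp only [Real.sinh_zero, zero_mul] at h
    exact nonpos_of_mul_nonpos_right h (mul_pos (Real.sinh_pos_iff.2 h0) (hBpos θ h0.le))
  have hG (θ : ℝ) (h0 : 0 ≤ θ) :
      HasDerivAt (fun θ => P.eval (Real.cosh θ) / B θ) (v θ / B θ) θ := by
    have hne := (hBpos θ h0).ne'
    refine ((hy P θ).div (hB θ h0) hne).congr_deriv ?_
    rw [hv]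
    field_simp
  have hGanti : AntitoneOn (fun θ => P.eval (Real.cosh θ) / B θ) (Set.Ici 0) := by
    refine antitoneOn_of_hasDerivWithinAt_nonpos (convex_Ici 0)
      (fun θ h => (hG θ h).continuousAt.continuousWithinAt)
      (fun θ h => (hG θ (interior_subset h)).hasDerivWithinAt) fun θ h => ?_
    rw [interior_Ici] at h
    exact div_nonpos_of_nonpos_of_nonneg (hv0 θ h) (hBpos θ h.le).le
  have h := hGanti Set.self_mem_Ici hθ hθ
  simp only [Real.cosh_zero, hB0, div_one] at h
  rw [show P.eval 1 = 1 from legendreP_eval_one n] at h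
  exact (div_le_one (hBpos θ hθ)).1 h

/-- For every integer `n ≥ 2` and every `t ≥ 1`,
`P_n(t) ≤ (t+√(t²-1))^{n(2n²-1)/(2n²-n-2)} (t + (2n²-1)/(n+1) √(t²-1))^{-n(n+1)/(2n²-n-2)}`. -/
theorem legendre_upper_bound_strong (n : ℕ) (hn : 2 ≤ n) :
    ∀ t : ℝ, 1 ≤ t →
      (legendreP n).eval t ≤
        (t + Real.sqrt (t ^ 2 - 1)) ^
            (((n : ℝ) * (2 * (n : ℝ) ^ 2 - 1)) / (2 * (n : ℝ) ^ 2 - (n : ℝ) - 2)) *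
        (t + (2 * (n : ℝ) ^ 2 - 1) / ((n : ℝ) + 1) * Real.sqrt (t ^ 2 - 1)) ^
            (-(((n : ℝ) * ((n : ℝ) + 1)) / (2 * (n : ℝ) ^ 2 - (n : ℝ) - 2))) := by
  intro t ht
  set x : ℝ := (n : ℝ)
  have hx : (2 : ℝ) ≤ x := Nat.ofNat_le_cast.2 hn
  have hb : 0 < 2 * x ^ 2 - 1 := by nlinarith
  have ha : 0 < x + 1 := by linarith
  have hm : 0 < 2 * x ^ 2 - x - 2 := by nlinarith
  have hD (θ : ℝ) (h : 0 ≤ θ) : 0 < (x + 1) * Real.cosh θ + (2 * x ^ 2 - 1) * Real.sinh θ := by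
    have := Real.cosh_pos θ
    have := Real.sinh_nonneg_iff.2 h
    positivity
  have hE (θ : ℝ) (h : 0 ≤ θ) :
      0 < Real.cosh θ + (2 * x ^ 2 - 1) / (x + 1) * Real.sinh θ := by
    have := Real.cosh_pos θ
    have := Real.sinh_nonneg_iff.2 h
    positivity
  have ht2 : 0 ≤ t ^ 2 - 1 := by nlinarith
  have hcosh : Real.cosh (Real.arsinh √(t ^ 2 - 1)) = t := by
    rw [Real.cosh_arsinh, Real.sq_sqrt ht2, add_sub_cancel, Real.sqrt_sq (by linarith)]
  have hexp : Real.exp (Real.arsinh √(t ^ 2 - 1)) = t + √(t ^ 2 - 1) := by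
    rw [← Real.cosh_add_sinh, hcosh, Real.sinh_arsinh]
  have key := legendreP_eval_cosh_le n
    (B := fun θ => Real.exp θ ^ (x * (2 * x ^ 2 - 1) / (2 * x ^ 2 - x - 2)) *
      (Real.cosh θ + (2 * x ^ 2 - 1) / (x + 1) * Real.sinh θ) ^
        (-(x * (x + 1) / (2 * x ^ 2 - x - 2))))
    (ψ := fun θ => x ^ 2 * (2 * x + 1) * Real.sinh θ /
      ((x + 1) * Real.cosh θ + (2 * x ^ 2 - 1) * Real.sinh θ))
    (ψ' := fun θ => x ^ 2 * (2 * x + 1) * (x + 1) /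
      ((x + 1) * Real.cosh θ + (2 * x ^ 2 - 1) * Real.sinh θ) ^ 2)
    (fun θ h => ?_) (fun θ h => ?_) ?_ (fun θ h => ?_) (fun θ h => ?_)
    (Real.arsinh_nonneg_iff.2 (Real.sqrt_nonneg (t ^ 2 - 1)))
  · simpa only [hcosh, hexp, Real.sinh_arsinh] using key
  · have hE' := hE θ h
    refine (((Real.hasDerivAt_exp θ).rpow_const (Or.inl (Real.exp_pos θ).ne')).mul
      (((Real.hasDerivAt_cosh θ).add ((Real.hasDerivAt_sinh θ).const_mul _)).rpow_const
        (Or.inl hE'.ne'))).congr_deriv ?_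
    simp only [Pi.add_apply]
    rw [Real.rpow_sub_one (Real.exp_pos θ).ne', Real.rpow_sub_one hE'.ne']
    have hD' := hD θ h
    have e : (x + 1) * Real.cosh θ + (2 * x ^ 2 - 1) * Real.sinh θ
        = (x + 1) * (Real.cosh θ + (2 * x ^ 2 - 1) / (x + 1) * Real.sinh θ) := by
      field_simp
    rw [e]
    have hlog : x * (2 * x ^ 2 - 1) / (2 * x ^ 2 - x - 2)
        - x * (x + 1) / (2 * x ^ 2 - x - 2)
          * ((Real.sinh θ + (2 * x ^ 2 - 1) / (x + 1) * Real.cosh θ) /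
            (Real.cosh θ + (2 * x ^ 2 - 1) / (x + 1) * Real.sinh θ))
        = x ^ 2 * (2 * x + 1) * Real.sinh θ /
          ((x + 1) * (Real.cosh θ + (2 * x ^ 2 - 1) / (x + 1) * Real.sinh θ)) := by
      rw [← e, show (Real.sinh θ + (2 * x ^ 2 - 1) / (x + 1) * Real.cosh θ) /
            (Real.cosh θ + (2 * x ^ 2 - 1) / (x + 1) * Real.sinh θ)
          = ((x + 1) * Real.sinh θ + (2 * x ^ 2 - 1) * Real.cosh θ) /
            ((x + 1) * Real.cosh θ + (2 * x ^ 2 - 1) * Real.sinh θ) by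
          rw [e]; field_simp]
      have := hD'.ne'
      have := hm.ne'
      rw [div_mul_div_comm, div_sub_div _ _ (by positivity) (by positivity),
        div_eq_div_iff (by positivity) (by positivity)]
      ring
    rw [← hlog]
    have := (Real.exp_pos θ).ne'
    generalize Real.exp θ ^ (x * (2 * x ^ 2 - 1) / (2 * x ^ 2 - x - 2)) = u
    generalize (Real.cosh θ + (2 * x ^ 2 - 1) / (x + 1) * Real.sinh θ) ^
        (-(x * (x + 1) / (2 * x ^ 2 - x - 2))) = w
    rw [show ∀ p, Real.exp θ * p * (u / Real.exp θ) = p * u by intro p; field_simp]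
    ring
  · exact mul_pos (Real.rpow_pos_of_pos (Real.exp_pos θ) _) (Real.rpow_pos_of_pos (hE θ h) _)
  · simp
  · have hD' := (hD θ h).ne'
    refine (((Real.hasDerivAt_sinh θ).const_mul (x ^ 2 * (2 * x + 1))).div
      (((Real.hasDerivAt_cosh θ).const_mul (x + 1)).add
        ((Real.hasDerivAt_sinh θ).const_mul (2 * x ^ 2 - 1))) hD').congr_deriv ?_
    simp only [Pi.add_apply]
    congr 1
    linear_combination x ^ 2 * (2 * x + 1) * (x + 1) * Real.cosh_sq θ
  · have hs := Real.sinh_nonneg_iff.2 h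
    have h1 := mul_le_mul_of_nonneg_left (legendre_riccati_supersolution (x := x) (by linarith) hs
      (Real.cosh_pos θ) (Real.cosh_sq_sub_sinh_sq θ)) hs
    calc _ = Real.sinh θ * (x * (x + 1)) := by ring
      _ ≤ _ := h1
      _ = _ := by ring
end
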